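/- Let either α ∈ (0,1) with δ ∈ (-1,1), or α = 1 with δ = 0, and let p be the density of Z ~ S_α(δ). Then there is a constant C_α > 0 such that ∫_ℝ |L^{α,δ} p(z)| dz ≤ C_α. -/

import Mathlib

open MeasureTheory Real Filter Set
open scoped Topology

noncomputable section

/-- Normalizing constant `d_α`. -/
def dconst (α : ℝ) : ℝ :=
  if α = 1 then 2 / π else -1 / (Real.Gamma (-α) * Real.cos (π * α / 2))

/-- Density of the Lévy measure `ν_{α,δ}` with respect to Lebesgue measure. -/
def nuDens (α δ : ℝ) (u : ℝ) : ℝ :=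
  dconst α * (if 0 < u then (1 + δ) / 2 * u ^ (-1 - α)
    else if u < 0 then (1 - δ) / 2 * |u| ^ (-1 - α) else 0)

/-- Generator `L^{α,δ}` for `α ∈ (0,1)`. -/
def Lop (α δ : ℝ) (f : ℝ → ℝ) (x : ℝ) : ℝ :=
  ∫ u, (f (x + u) - f x) * nuDens α δ u

/-- Generator `L^{1,0}` (note `ν_{1,0}(du) = (2/π)|u|⁻²/2 du = 1/(π u²) du`). -/
def Lop1 (f : ℝ → ℝ) (x : ℝ) : ℝ :=
  ∫ u, (f (x + u) - f x - (if |u| ≤ 1 then u * deriv f x else 0)) * (1 / (π * u ^ 2))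

/-- Combined generator. -/
def LopA (α δ : ℝ) (f : ℝ → ℝ) (x : ℝ) : ℝ :=
  if α = 1 then Lop1 f x else Lop α δ f x

/-- Characteristic function of the strictly `α`-stable law at time `t`. -/
def stableCF (α δ t l : ℝ) : ℂ :=
  if α = 1 then Complex.exp (↑(-(t * |l|)) : ℂ)
  else Complex.exp ((↑(-(t * |l| ^ α)) : ℂ) *
    (1 - Complex.I * (δ : ℂ) * ((Real.sign l : ℝ) : ℂ) * ((Real.tan (π * α / 2) : ℝ) : ℂ)))

/-- `μ` is the strictly `α`-stable law `S_α(δ)`. -/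
def IsStableLaw (α δ : ℝ) (μ : Measure ℝ) : Prop :=
  ∀ l : ℝ, (∫ x, Complex.exp (Complex.I * (l : ℂ) * (x : ℂ)) ∂μ) = stableCF α δ 1 l

/-- The class `H_β`. -/
def memHbeta (β : ℝ) (h : ℝ → ℝ) : Prop :=
  ∀ x y : ℝ, |h x - h y| ≤ min |x - y| (|x - y| ^ β)

/-- The distance `d_{W_β}`. -/
def dWbeta (β : ℝ) (μ ν : Measure ℝ) : ℝ :=
  sSup { r | ∃ h : ℝ → ℝ, memHbeta β h ∧ r = |(∫ x, h x ∂μ) - ∫ x, h x ∂ν| }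

/-- The Kolmogorov distance. -/
def dKol (μ ν : Measure ℝ) : ℝ :=
  sSup { r | ∃ x : ℝ, r = |(μ (Set.Iic x)).toReal - (ν (Set.Iic x)).toReal| }

/-- The solution of Stein's equation. -/
def steinSol (α : ℝ) (p h : ℝ → ℝ) (x : ℝ) : ℝ :=
  -∫ t in Set.Ioi (0:ℝ), ∫ y, p y *
    (h ((1 - Real.exp (-t)) ^ (1/α) * y + Real.exp (-t/α) * x) - h y)

lemma aux_intOn {α s : ℝ} (hα : 0 < α) (hs : -1 < s) :
    IntegrableOn (fun x : ℝ => x ^ s * Real.exp (-x ^ α)) (Ioi 0) := by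
  by_contra h
  have h1 := integral_rpow_mul_exp_neg_rpow hα hs
  rw [integral_undef h] at h1
  have : 0 < 1 / α * Real.Gamma ((s + 1) / α) :=
    mul_pos (by positivity) (Real.Gamma_pos_of_pos (div_pos (by linarith) hα))
  linarith

lemma aux_int_abs {α : ℝ} (hα : 0 < α) :
    Integrable (fun x : ℝ => Real.exp (-|x| ^ α)) := by
  by_contra h
  have h1 := integral_comp_abs (f := fun x : ℝ => Real.exp (-x ^ α))
  rw [integral_undef h, integral_exp_neg_rpow hα] at h1
  have : 0 < Real.Gamma (1 / α + 1) := Real.Gamma_pos_of_pos (by positivity)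
  linarith

lemma aux_tendsto {α : ℝ} (hα : 0 < α) (s : ℝ) :
    Tendsto (fun x : ℝ => x ^ s * Real.exp (-x ^ α)) atTop (𝓝 0) := by
  have h := (tendsto_rpow_mul_exp_neg_mul_atTop_nhds_zero (s / α) 1 one_pos).comp
    (tendsto_rpow_atTop hα)
  refine h.congr' ?_
  filter_upwards [eventually_gt_atTop 0] with x hx
  simp only [Function.comp, ← Real.rpow_mul hx.le, mul_div_cancel₀ s hα.ne', neg_mul, one_mul]

/-- kernel -/
def ek (α : ℝ) (c : ℂ) (x l : ℝ) : ℂ :=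
  Complex.exp (-Complex.I * x * l) * Complex.exp (-c * ((l ^ α : ℝ) : ℂ))

lemma norm_ek {α : ℝ} {c : ℂ} (hc : c.re = 1) (x l : ℝ) :
    ‖ek α c x l‖ = Real.exp (-l ^ α) := by
  rw [ek, norm_mul, Complex.norm_exp, Complex.norm_exp]
  simp [hc]

lemma meas_ek (α : ℝ) (c : ℂ) (x : ℝ) : Measurable (ek α c x) := by
  unfold ek; fun_prop

lemma ek_deriv_x (α : ℝ) (c : ℂ) (x l : ℝ) :
    HasDerivAt (fun y : ℝ => ek α c y l) (-Complex.I * l * ek α c x l) x := by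
  have h : HasDerivAt (fun y : ℝ => -Complex.I * (y : ℂ) * l) (-Complex.I * l) x := by
    have := ((Complex.ofRealCLM.hasDerivAt (x := x)).const_mul (-Complex.I)).mul_const (l : ℂ)
    simpa using this
  have := h.cexp.mul_const (Complex.exp (-c * ((l ^ α : ℝ) : ℂ)))
  refine this.congr_deriv ?_
  rw [ek]; ring

def Gf (α : ℝ) (c : ℂ) (x : ℝ) : ℂ := ∫ l in Ioi (0 : ℝ), ek α c x l
def Gd (α : ℝ) (c : ℂ) (x : ℝ) : ℂ := ∫ l in Ioi (0 : ℝ), -Complex.I * l * ek α c x l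

lemma int_ek {α : ℝ} (hα : 0 < α) {c : ℂ} (hc : c.re = 1) (x : ℝ) :
    IntegrableOn (ek α c x) (Ioi 0) := by
  refine (aux_intOn (s := 0) hα (by norm_num)).mono' (meas_ek α c x).aestronglyMeasurable ?_
  refine Eventually.of_forall fun l => ?_
  simp [norm_ek hc]

lemma int_rpow_ek {α s : ℝ} (hα : 0 < α) (hs : -1 < s) {c : ℂ} (hc : c.re = 1) (x : ℝ) :
    IntegrableOn (fun l : ℝ => ((l ^ s : ℝ) : ℂ) * ek α c x l) (Ioi 0) := by
  refine (aux_intOn (s := s) hα hs).mono' ?_ ?_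
  · exact (Measurable.mul (by fun_prop) (meas_ek α c x)).aestronglyMeasurable
  · filter_upwards [ae_restrict_mem measurableSet_Ioi] with l hl
    rw [norm_mul, norm_ek hc, Complex.norm_real, Real.norm_of_nonneg (Real.rpow_nonneg (le_of_lt hl) _)]

lemma Gf_deriv {α : ℝ} (hα : 0 < α) {c : ℂ} (hc : c.re = 1) (x : ℝ) :
    HasDerivAt (Gf α c) (Gd α c x) x := by
  refine (hasDerivAt_integral_of_dominated_loc_of_deriv_le (F := fun y l => ek α c y l)
    (F' := fun y l => -Complex.I * l * ek α c y l)
    (bound := fun l : ℝ => l ^ (1:ℝ) * Real.exp (-l ^ α)) (s := univ) univ_mem ?_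
    (int_ek hα hc x) ?_ ?_ (aux_intOn hα (by norm_num)) ?_).2
  · exact Eventually.of_forall fun y => (meas_ek α c y).aestronglyMeasurable
  · exact (Measurable.mul (by fun_prop) (meas_ek α c x)).aestronglyMeasurable
  · filter_upwards [ae_restrict_mem measurableSet_Ioi] with l hl y _
    rw [norm_mul, norm_ek hc]
    simp [abs_of_pos (show (0:ℝ) < l from hl)]
  · exact Eventually.of_forall fun l y _ => ek_deriv_x α c y l

lemma ek_deriv_l {α : ℝ} (c : ℂ) (x l : ℝ) (hl : 0 < l) :
    HasDerivAt (fun l : ℝ => ek α c x l)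
      ((-Complex.I * x - c * α * ((l ^ (α - 1) : ℝ) : ℂ)) * ek α c x l) l := by
  have h1 : HasDerivAt (fun y : ℝ => -Complex.I * (x : ℂ) * y) (-Complex.I * x) l := by
    have := ((Complex.ofRealCLM.hasDerivAt (x := l)).const_mul (-Complex.I * (x:ℂ)))
    simpa using this
  have h2 : HasDerivAt (fun y : ℝ => -c * ((y ^ α : ℝ) : ℂ)) (-c * ((α * l ^ (α - 1) : ℝ) : ℂ)) l :=
    ((Real.hasDerivAt_rpow_const (p := α) (Or.inl hl.ne')).ofReal_comp).const_mul (-c)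
  refine (h1.cexp.mul h2.cexp).congr_deriv ?_
  rw [ek]; push_cast; ring

lemma Gd_ibp {α : ℝ} (hα : 0 < α) {c : ℂ} (hc : c.re = 1) (x : ℝ) :
    (-Complex.I * x) ^ 2 * ∫ l in Ioi (0 : ℝ), (l : ℂ) * ek α c x l =
      1 + ∫ l in Ioi (0 : ℝ), (-c * α * (α + 1) * ((l ^ (α - 1) : ℝ) : ℂ)
        + c ^ 2 * α ^ 2 * ((l ^ (2 * α - 1) : ℝ) : ℂ)) * ek α c x l := by
  set a : ℂ := -Complex.I * x with ha
  have i1 : IntegrableOn (fun l : ℝ => (l : ℂ) * ek α c x l) (Ioi 0) := by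
    simpa using int_rpow_ek (s := 1) hα (by norm_num) hc x
  have i2 : IntegrableOn (fun l : ℝ => (-c * α * (α + 1) * ((l ^ (α - 1) : ℝ) : ℂ)
        + c ^ 2 * α ^ 2 * ((l ^ (2 * α - 1) : ℝ) : ℂ)) * ek α c x l) (Ioi 0) := by
    have := ((int_rpow_ek (s := α - 1) hα (by linarith) hc x).const_mul (-c * α * (α + 1))).add
      ((int_rpow_ek (s := 2 * α - 1) hα (by linarith) hc x).const_mul (c ^ 2 * α ^ 2))
    refine this.congr (Eventually.of_forall fun l => ?_)
    simp only [Pi.add_apply]; ring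
  have key := integral_Ioi_of_hasDerivAt_of_tendsto (a := 0) (m := 0)
    (f := fun l : ℝ => (a * l - (1 - c * α * ((l ^ α : ℝ) : ℂ))) * ek α c x l)
    (f' := fun l : ℝ => a ^ 2 * ((l : ℂ) * ek α c x l) -
      (-c * α * (α + 1) * ((l ^ (α - 1) : ℝ) : ℂ)
        + c ^ 2 * α ^ 2 * ((l ^ (2 * α - 1) : ℝ) : ℂ)) * ek α c x l)
    ?_ ?_ (by exact (i1.const_mul (a ^ 2)).sub i2) ?_
  · rw [integral_sub (i1.const_mul _) i2, integral_const_mul] at key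
    have : (a * ((0:ℝ):ℂ) - (1 - c * α * (((0:ℝ) ^ α : ℝ) : ℂ))) * ek α c x 0 = -1 := by
      simp [ek, Real.zero_rpow hα.ne']
    rw [this] at key
    linear_combination key
  · apply Continuous.continuousWithinAt
    have : Continuous (fun l : ℝ => l ^ α) := Real.continuous_rpow_const hα.le
    unfold ek
    fun_prop
  · intro l hl
    have hl : 0 < l := hl
    have h1 : HasDerivAt (fun y : ℝ => a * (y : ℂ)) a l := by
      simpa using ((Complex.ofRealCLM.hasDerivAt (x := l)).const_mul a)
    have h2 : HasDerivAt (fun y : ℝ => c * α * ((y ^ α : ℝ) : ℂ))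
        (c * α * ((α * l ^ (α - 1) : ℝ) : ℂ)) l :=
      ((Real.hasDerivAt_rpow_const (p := α) (Or.inl hl.ne')).ofReal_comp).const_mul (c * α)
    refine ((h1.sub ((hasDerivAt_const l (1:ℂ)).sub h2)).mul (ek_deriv_l c x l hl)).congr_deriv ?_
    have e1 : ((l ^ α : ℝ) : ℂ) = l * ((l ^ (α - 1) : ℝ) : ℂ) := by
      rw [← Complex.ofReal_mul, Real.rpow_sub_one hl.ne']; field_simp
    have e2 : ((l ^ (2 * α - 1) : ℝ) : ℂ) = l * ((l ^ (α - 1) : ℝ) : ℂ) ^ 2 := by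
      rw [← Complex.ofReal_pow, ← Complex.ofReal_mul, ← Real.rpow_natCast, ← Real.rpow_mul hl.le]
      nth_rw 2 [← Real.rpow_one l]
      rw [← Real.rpow_add hl]; congr 2; push_cast; ring
    simp only [Pi.sub_apply]
    rw [e1, e2, ← ha]; push_cast; ring
  · rw [tendsto_zero_iff_norm_tendsto_zero]
    have t1 := (aux_tendsto hα 1).const_mul ‖a‖
    have t2 := (aux_tendsto hα 0)
    have t3 := (aux_tendsto hα α).const_mul ‖c * α‖
    have t := (t1.add t2).add t3
    simp only [mul_zero, add_zero] at t
    refine squeeze_zero' (Eventually.of_forall fun _ => norm_nonneg _) ?_ t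
    filter_upwards [eventually_gt_atTop 0] with l hl
    rw [norm_mul, norm_ek hc, ← mul_assoc, ← add_mul, ← mul_assoc, ← add_mul]
    refine mul_le_mul_of_nonneg_right ?_ (Real.exp_pos _).le
    refine (norm_sub_le _ _).trans ?_
    have := norm_sub_le (1:ℂ) (c * α * ((l ^ α : ℝ) : ℂ))
    rw [norm_one, norm_mul (c * α), Complex.norm_real,
      Real.norm_of_nonneg (Real.rpow_nonneg hl.le _)] at this
    rw [norm_mul a, Complex.norm_real, Real.norm_of_nonneg hl.le, Real.rpow_one, Real.rpow_zero]
    linarith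

lemma Gd_bound {α : ℝ} (hα : 0 < α) {c : ℂ} (hc : c.re = 1) :
    ∃ K : ℝ, 0 ≤ K ∧ ∀ x, ‖Gd α c x‖ ≤ K / (1 + x ^ 2) := by
  set A := ‖-c * α * (α + 1)‖
  set B := ‖c ^ 2 * (α:ℂ) ^ 2‖
  set K0 := ∫ l in Ioi (0 : ℝ), l ^ (1:ℝ) * Real.exp (-l ^ α)
  set K2 := ∫ l in Ioi (0 : ℝ), (A * (l ^ (α - 1) * Real.exp (-l ^ α)) +
    B * (l ^ (2 * α - 1) * Real.exp (-l ^ α)))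
  have hK0 : 0 ≤ K0 := setIntegral_nonneg measurableSet_Ioi fun l hl => by
    have : 0 < l := hl
    positivity
  have hK2 : 0 ≤ K2 := setIntegral_nonneg measurableSet_Ioi fun l hl => by
    have : 0 < l := hl
    positivity
  have i0 := aux_intOn (s := 1) hα (by norm_num)
  have i2 := ((aux_intOn (s := α - 1) hα (by linarith)).const_mul A).add
    ((aux_intOn (s := 2 * α - 1) hα (by linarith)).const_mul B)
  refine ⟨K0 + (1 + K2), by positivity, fun x => ?_⟩
  rw [le_div_iff₀ (by positivity)]
  have e : Gd α c x = -Complex.I * ∫ l in Ioi (0 : ℝ), (l : ℂ) * ek α c x l := by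
    rw [Gd, ← integral_const_mul]; simp only [mul_assoc]
  set J := ∫ l in Ioi (0 : ℝ), (l : ℂ) * ek α c x l with hJ
  have n : ‖Gd α c x‖ = ‖J‖ := by rw [e]; simp
  have b0 : ‖J‖ ≤ K0 := by
    refine norm_integral_le_of_norm_le i0 ?_
    filter_upwards [ae_restrict_mem measurableSet_Ioi] with l hl
    rw [norm_mul, norm_ek hc, Complex.norm_real, Real.norm_of_nonneg (le_of_lt hl), Real.rpow_one]
  have b2 : x ^ 2 * ‖J‖ ≤ 1 + K2 := by
    have h := Gd_ibp hα hc x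
    have : x ^ 2 * ‖J‖ = ‖(-Complex.I * x) ^ 2 * J‖ := by simp
    rw [this, h]
    refine (norm_add_le _ _).trans ?_
    rw [norm_one]
    gcongr
    refine norm_integral_le_of_norm_le i2 ?_
    filter_upwards [ae_restrict_mem measurableSet_Ioi] with l hl
    have hl' : 0 ≤ l := le_of_lt hl
    rw [norm_mul, norm_ek hc]
    simp only [← mul_assoc, ← add_mul]
    refine mul_le_mul_of_nonneg_right ?_ (Real.exp_pos _).le
    refine (norm_add_le _ _).trans ?_
    rw [norm_mul _ (((l ^ (α - 1) : ℝ) : ℂ)), norm_mul _ (((l ^ (2 * α - 1) : ℝ) : ℂ)), Complex.norm_real, Complex.norm_real,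
      Real.norm_of_nonneg (Real.rpow_nonneg hl' _), Real.norm_of_nonneg (Real.rpow_nonneg hl' _)]
  rw [n]; linarith

lemma density_eq {α : ℝ} (hα : 0 < α) {c c' : ℂ} (hc : c.re = 1) (hc' : c'.re = 1)
    (φ : ℝ → ℂ) (h1 : ∀ l : ℝ, 0 < l → φ l = Complex.exp (-c * ((l ^ α : ℝ) : ℂ)))
    (h2 : ∀ l : ℝ, 0 < l → φ (-l) = Complex.exp (-c' * ((l ^ α : ℝ) : ℂ)))
    (p : ℝ → ℝ) (hpc : Continuous p) (hpi : Integrable p)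
    (hcf : ∀ l : ℝ, ∫ x : ℝ, Complex.exp (Complex.I * l * x) * (p x : ℂ) = φ l) (x : ℝ) :
    (p x : ℂ) = (Gf α c x + Gf α c' (-x)) / (2 * π) := by
  have hpos : ∀ x : ℝ, EqOn (fun l : ℝ => Complex.exp (-Complex.I * x * l) * φ l) (ek α c x) (Ioi 0) := by
    intro x l hl
    simp only [ek, h1 l hl]
  have hneg : ∀ x : ℝ, EqOn (fun l : ℝ => Complex.exp (-Complex.I * x * (-l : ℝ)) * φ (-l))
      (ek α c' (-x)) (Ioi 0) := by
    intro x l hl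
    simp only [ek, h2 l hl]
    congr 2
    push_cast; ring
  have i1 : ∀ x : ℝ, IntegrableOn (fun l : ℝ => Complex.exp (-Complex.I * x * l) * φ l) (Ioi 0) :=
    fun x => (int_ek hα hc x).congr_fun (hpos x).symm measurableSet_Ioi
  have i2 : ∀ x : ℝ, IntegrableOn (fun l : ℝ => Complex.exp (-Complex.I * x * l) * φ l) (Iic 0) := by
    intro x
    have h : IntegrableOn (fun l : ℝ => Complex.exp (-Complex.I * x * (-l : ℝ)) * φ (-l)) (Ioi (-0)) := by
      rw [neg_zero]
      exact (int_ek hα hc' (-x)).congr_fun (hneg x).symm measurableSet_Ioi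
    have := h.comp_neg_Iio
    rw [integrableOn_Iic_iff_integrableOn_Iio]
    simpa using this
  have iφ : Integrable φ := by
    rw [← integrableOn_univ, ← Iic_union_Ioi (a := (0:ℝ))]
    simpa using (i2 0).union (i1 0)
  have hF : ∀ w : ℝ, FourierTransform.fourier (fun x => (p x : ℂ)) w = φ (-(2 * π) * w) := by
    intro w
    rw [Real.fourier_real_eq_integral_exp_smul, ← hcf]
    congr 1; ext v
    rw [smul_eq_mul]
    congr 2
    push_cast; ring
  have hF' : FourierTransform.fourier (fun x => (p x : ℂ)) = fun w : ℝ => φ (-(2 * π) * w) := funext hF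
  have inv := Continuous.fourierInv_fourier_eq (f := fun x => (p x : ℂ)) (by fun_prop) hpi.ofReal
    (by rw [hF']; exact iφ.comp_mul_left' (by simp [Real.pi_ne_zero]))
  have := congrFun inv x
  rw [hF', Real.fourierInv_eq'] at this
  rw [← this]
  have e : (fun v : ℝ => Complex.exp (↑(2 * π * inner ℝ v x) * Complex.I) • φ (-(2 * π) * v)) =
      fun v => (fun l : ℝ => Complex.exp (-Complex.I * x * l) * φ l) (-(2 * π) * v) := by
    ext v
    rw [smul_eq_mul]
    congr 2
    simp; ring
  rw [e, Measure.integral_comp_mul_left (fun l : ℝ => Complex.exp (-Complex.I * x * l) * φ l)]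
  rw [← intervalIntegral.integral_Iic_add_Ioi (i2 x) (i1 x), setIntegral_congr_fun measurableSet_Ioi (hpos x)]
  have e2 : ∫ l in Iic (0:ℝ), Complex.exp (-Complex.I * x * l) * φ l = Gf α c' (-x) := by
    have := integral_comp_neg_Ioi 0 (fun l : ℝ => Complex.exp (-Complex.I * x * l) * φ l)
    rw [neg_zero] at this
    rw [← this, Gf]
    exact setIntegral_congr_fun measurableSet_Ioi (hneg x)
  rw [e2, ← Gf]
  rw [abs_inv, abs_neg, abs_of_pos (by positivity), Complex.real_smul]
  push_cast
  field_simp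
  ring

lemma int_abs {f : ℝ → ℝ} (hf : IntegrableOn f (Ioi 0)) : Integrable (fun x => f |x|) := by
  rw [← integrableOn_univ, ← Iic_union_Ioi (a := (0:ℝ))]
  refine IntegrableOn.union ?_ (hf.congr_fun (fun x hx => ?_) measurableSet_Ioi)
  · rw [integrableOn_Iic_iff_integrableOn_Iio]
    have h : IntegrableOn f (Ioi (-0)) := by simpa using hf
    refine h.comp_neg_Iio.congr_fun (fun x hx => ?_) measurableSet_Iio
    simp only [abs_of_neg (show x < 0 from hx)]
  · simp only [abs_of_pos (show 0 < x from hx)]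

def wf (s u : ℝ) : ℝ := if |u| ≤ 1 then |u| ^ s else 0
def kf (s u : ℝ) : ℝ := if |u| ≤ 1 then 0 else |u| ^ s

lemma wf_int {s : ℝ} (hs : -1 < s) : Integrable (wf s) := by
  refine int_abs (f := fun x => if x ≤ 1 then x ^ s else 0) ?_
  rw [← Ioc_union_Ioi_eq_Ioi zero_le_one]
  refine IntegrableOn.union ?_ ?_
  · have := (intervalIntegral.intervalIntegrable_rpow' (a := 0) (b := 1) hs)
    rw [intervalIntegrable_iff_integrableOn_Ioc_of_le zero_le_one] at this
    exact this.congr_fun (fun x hx => by simp [hx.2]) measurableSet_Ioc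
  · exact integrableOn_zero.congr_fun (fun x hx => by simp [not_le.2 (show 1 < x from hx)]) measurableSet_Ioi

lemma kf_int {s : ℝ} (hs : s < -1) : Integrable (kf s) := by
  refine int_abs (f := fun x => if x ≤ 1 then 0 else x ^ s) ?_
  rw [← Ioc_union_Ioi_eq_Ioi zero_le_one]
  refine IntegrableOn.union ?_ ?_
  · exact integrableOn_zero.congr_fun (fun x hx => by simp [hx.2]) measurableSet_Ioc
  · exact (integrableOn_Ioi_rpow_of_lt hs one_pos).congr_fun
      (fun x hx => by simp [not_le.2 (show 1 < x from hx)]) measurableSet_Ioi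

lemma wf_nonneg (s u : ℝ) : 0 ≤ wf s u := by unfold wf; split_ifs <;> positivity
lemma kf_nonneg (s u : ℝ) : 0 ≤ kf s u := by unfold kf; split_ifs <;> positivity
lemma wf_meas (s : ℝ) : Measurable (wf s) := by
  unfold wf
  exact Measurable.ite (measurableSet_le (by fun_prop) (by fun_prop)) (by fun_prop) (by fun_prop)
lemma kf_meas (s : ℝ) : Measurable (kf s) := by
  unfold kf
  exact Measurable.ite (measurableSet_le (by fun_prop) (by fun_prop)) (by fun_prop) (by fun_prop)

lemma final_bound (D : ℝ → ℝ → ℝ) {s t K M : ℝ} (hs : -1 < s) (ht : t < -1) (hK : 0 ≤ K)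
    (hM : 0 ≤ M) (p : ℝ → ℝ) (hp0 : ∀ x, 0 ≤ p x) (hpc : Continuous p) (hpi : Integrable p)
    (h : ∀ z u, |D z u| ≤ K / (1 + z ^ 2) * wf s u + (p (z + u) + p z) * (M * kf t u)) :
    ∃ C > 0, (∫⁻ z, ENNReal.ofReal |∫ u, D z u|) ≤ ENNReal.ofReal C := by
  have hlt : (∫⁻ z, ENNReal.ofReal |∫ u, D z u|) < ⊤ := by
    have mw := (wf_meas s).ennreal_ofReal
    have mk := ((kf_meas t).const_mul M).ennreal_ofReal
    have mp := hpc.measurable.ennreal_ofReal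
    calc (∫⁻ z, ENNReal.ofReal |∫ u, D z u|)
      _ ≤ ∫⁻ z, ∫⁻ u, (ENNReal.ofReal (K / (1 + z ^ 2)) * ENNReal.ofReal (wf s u) +
          (ENNReal.ofReal (p (z + u)) + ENNReal.ofReal (p z)) * ENNReal.ofReal (M * kf t u)) := by
        refine lintegral_mono fun z => ?_
        rw [← Real.norm_eq_abs, ofReal_norm]
        refine (enorm_integral_le_lintegral_enorm _).trans (lintegral_mono fun u => ?_)
        rw [← ofReal_norm, Real.norm_eq_abs]
        refine (ENNReal.ofReal_le_ofReal (h z u)).trans ?_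
        have a1 : 0 ≤ K / (1 + z ^ 2) := by positivity
        have a2 := wf_nonneg s u
        have a3 := mul_nonneg hM (kf_nonneg t u)
        have a4 := hp0 z
        have a5 := hp0 (z + u)
        rw [ENNReal.ofReal_add (by positivity) (by positivity), ENNReal.ofReal_mul a1,
          ENNReal.ofReal_mul (by positivity), ENNReal.ofReal_add a5 a4]
      _ = (∫⁻ z, ∫⁻ u, ENNReal.ofReal (K / (1 + z ^ 2)) * ENNReal.ofReal (wf s u)) +
          ∫⁻ z, ∫⁻ u, (ENNReal.ofReal (p (z + u)) + ENNReal.ofReal (p z)) * ENNReal.ofReal (M * kf t u) := by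
        rw [← lintegral_add_left]
        · congr 1; ext z
          rw [lintegral_add_left]
          exact mw.const_mul _
        · simp_rw [lintegral_const_mul _ mw]
          fun_prop
      _ = (∫⁻ z, ENNReal.ofReal (K / (1 + z ^ 2))) * (∫⁻ u, ENNReal.ofReal (wf s u)) +
          ((∫⁻ z, ENNReal.ofReal (p z)) + ∫⁻ z, ENNReal.ofReal (p z)) * ∫⁻ u, ENNReal.ofReal (M * kf t u) := by
        congr 1
        · simp_rw [lintegral_const_mul _ mw]
          rw [lintegral_mul_const _ (by fun_prop)]
        · rw [lintegral_lintegral_swap]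
          · rw [← lintegral_const_mul _ mk]
            congr 1; ext u
            rw [lintegral_mul_const _ (by fun_prop), lintegral_add_right _ mp,
              lintegral_add_right_eq_self (fun z => ENNReal.ofReal (p z))]
          · apply Measurable.aemeasurable
            have m1 : Measurable (fun a : ℝ × ℝ => ENNReal.ofReal (M * kf t a.2)) := mk.comp measurable_snd
            have m2 : Measurable (fun a : ℝ × ℝ => ENNReal.ofReal (p (a.1 + a.2))) :=
              mp.comp (measurable_fst.add measurable_snd)
            have m3 : Measurable (fun a : ℝ × ℝ => ENNReal.ofReal (p a.1)) := mp.comp measurable_fst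
            exact (m2.add m3).mul m1
      _ < ⊤ := by
        have b1 : (∫⁻ z, ENNReal.ofReal (K / (1 + z ^ 2))) < ⊤ := by
          have := (integrable_inv_one_add_sq.const_mul K).lintegral_lt_top
          simpa [div_eq_mul_inv] using this
        have b2 := (wf_int hs).lintegral_lt_top
        have b3 := hpi.lintegral_lt_top
        have b4 := ((kf_int ht).const_mul M).lintegral_lt_top
        exact ENNReal.add_lt_top.2 ⟨ENNReal.mul_lt_top b1 b2,
          ENNReal.mul_lt_top (ENNReal.add_lt_top.2 ⟨b3, b3⟩) b4⟩
  refine ⟨(∫⁻ z, ENNReal.ofReal |∫ u, D z u|).toReal + 1, by positivity, ?_⟩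
  rw [ENNReal.le_ofReal_iff_toReal_le hlt.ne (by positivity)]
  linarith

lemma nuDens_le {α δ : ℝ} (hδ : δ ∈ Set.Ioo (-1 : ℝ) 1) (u : ℝ) :
    |nuDens α δ u| ≤ |dconst α| * |u| ^ (-1 - α) := by
  obtain ⟨d1, d2⟩ := hδ
  unfold nuDens
  rw [abs_mul]
  refine mul_le_mul_of_nonneg_left ?_ (abs_nonneg _)
  have hr : 0 ≤ |u| ^ (-1 - α) := by positivity
  split_ifs with a b
  · rw [abs_of_pos a] at hr ⊢
    rw [abs_of_nonneg (mul_nonneg (by linarith) hr)]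
    nlinarith
  · rw [abs_of_nonneg (mul_nonneg (by linarith) hr)]
    nlinarith
  · simpa using hr

lemma p_diff {α : ℝ} (hα : 0 < α) {c c' : ℂ} (hc : c.re = 1) (hc' : c'.re = 1)
    (p : ℝ → ℝ) (hp : ∀ x : ℝ, (p x : ℂ) = (Gf α c x + Gf α c' (-x)) / (2 * π)) :
    ∃ K, 0 ≤ K ∧ ∀ x u : ℝ, |u| ≤ 1 → |p (x + u) - p x| ≤ K / (1 + x ^ 2) * |u| := by
  obtain ⟨K, hK, h1⟩ := Gd_bound hα hc
  obtain ⟨K', hK', h2⟩ := Gd_bound hα hc'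
  refine ⟨3 * (K + K'), by positivity, fun x u hu => ?_⟩
  set q : ℝ → ℂ := fun x => (Gf α c x + Gf α c' (-x)) / (2 * π) with hq
  have hd : ∀ y, HasDerivAt q ((Gd α c y - Gd α c' (-y)) / (2 * π)) y := by
    intro y
    have := ((Gf_deriv hα hc' (-y)).scomp y (hasDerivAt_neg y))
    refine (((Gf_deriv hα hc y).add this).div_const (2 * π : ℂ)).congr_deriv ?_
    simp [sub_eq_add_neg]
  have hb : ∀ y ∈ Metric.closedBall x 1, ‖(Gd α c y - Gd α c' (-y)) / (2 * π)‖ ≤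
      3 * (K + K') / (1 + x ^ 2) := by
    intro y hy
    rw [norm_div]
    have n2 : 1 ≤ ‖(2 * π : ℂ)‖ := by
      rw [norm_mul, Complex.norm_real, Real.norm_of_nonneg Real.pi_pos.le]
      simp; linarith [Real.pi_gt_three]
    refine (div_le_self (norm_nonneg _) n2).trans ((norm_sub_le _ _).trans ?_)
    have b1 := h1 y
    have b2 := h2 (-y)
    rw [neg_sq] at b2
    refine (add_le_add b1 b2).trans ?_
    rw [← add_div, div_le_div_iff₀ (by positivity) (by positivity)]
    rw [Metric.mem_closedBall, Real.dist_eq, abs_le] at hy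
    have : 1 + x ^ 2 ≤ 3 * (1 + y ^ 2) := by nlinarith [sq_nonneg (2 * y - x)]
    nlinarith [mul_le_mul_of_nonneg_left this (add_nonneg hK hK')]
  have := (convex_closedBall x 1).norm_image_sub_le_of_norm_hasDerivWithin_le
    (fun y _ => (hd y).hasDerivWithinAt) hb (x := x) (y := x + u) (by simp) (by simpa using hu)
  rw [hq] at this
  simp only [← hp] at this
  rw [← Complex.ofReal_sub, Complex.norm_real] at this
  simpa using this

lemma case_lt {α δ : ℝ} (hα : 0 < α) (hα1 : α < 1) (hδ : δ ∈ Set.Ioo (-1 : ℝ) 1)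
    (p : ℝ → ℝ) (hp0 : ∀ x, 0 ≤ p x) (hpc : Continuous p) (hpi : Integrable p)
    (hd : ∃ K, 0 ≤ K ∧ ∀ x u : ℝ, |u| ≤ 1 → |p (x + u) - p x| ≤ K / (1 + x ^ 2) * |u|) :
    ∃ C > 0, (∫⁻ z, ENNReal.ofReal |Lop α δ p z|) ≤ ENNReal.ofReal C := by
  obtain ⟨K, hK, hd⟩ := hd
  refine final_bound (fun z u => (p (z + u) - p z) * nuDens α δ u) (s := -α) (t := -1 - α)
    (K := K * |dconst α|) (M := |dconst α|) (by linarith) (by linarith) (by positivity)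
    (by positivity) p hp0 hpc hpi ?_
  intro z u
  rw [abs_mul]
  have hn := nuDens_le (α := α) hδ u
  unfold wf kf
  split_ifs with hu
  · by_cases h0 : u = 0
    · simp only [h0, nuDens]; simp; positivity
    have hu0 : 0 < |u| := abs_pos.2 h0
    calc _ ≤ (K / (1 + z ^ 2) * |u|) * (|dconst α| * |u| ^ (-1 - α)) :=
          mul_le_mul (hd z u hu) hn (abs_nonneg _) (by positivity)
      _ = _ := by
        have : |u| ^ (-α) = |u| * |u| ^ (-1 - α) := by
          nth_rw 2 [← Real.rpow_one |u|]
          rw [← Real.rpow_add hu0]; congr 1; ring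
        rw [this]; ring
  · rw [mul_zero, zero_add]
    refine mul_le_mul ?_ hn (abs_nonneg _) (add_nonneg (hp0 _) (hp0 _))
    rw [abs_le]; constructor <;> linarith [hp0 z, hp0 (z + u)]

lemma cauchy_diff (x u : ℝ) (hu : |u| ≤ 1) :
    |1 / (1 + (x + u) ^ 2) - 1 / (1 + x ^ 2) - u * (-(2 * x) / (1 + x ^ 2) ^ 2)| ≤
      6 / (1 + x ^ 2) * u ^ 2 := by
  have e : 1 / (1 + (x + u) ^ 2) - 1 / (1 + x ^ 2) - u * (-(2 * x) / (1 + x ^ 2) ^ 2) =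
      u ^ 2 * (-(1 + x ^ 2) + 4 * x ^ 2 + 2 * x * u) / ((1 + x ^ 2) ^ 2 * (1 + (x + u) ^ 2)) := by
    have : 1 + x ^ 2 ≠ 0 := by positivity
    have : 1 + (x + u) ^ 2 ≠ 0 := by positivity
    field_simp; ring
  rw [e, abs_div, abs_of_pos (show 0 < (1 + x ^ 2) ^ 2 * (1 + (x + u) ^ 2) by positivity),
    div_le_iff₀ (by positivity), abs_mul, abs_of_nonneg (sq_nonneg u)]
  have h1 : |-(1 + x ^ 2) + 4 * x ^ 2 + 2 * x * u| ≤ 6 * (1 + x ^ 2) := by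
    rw [abs_le] at hu ⊢
    constructor <;> nlinarith [sq_nonneg (x - u), sq_nonneg (x + u)]
  calc _ ≤ u ^ 2 * (6 * (1 + x ^ 2) * (1 + (x + u) ^ 2)) := by
        refine mul_le_mul_of_nonneg_left (h1.trans ?_) (sq_nonneg u)
        exact le_mul_of_one_le_right (by positivity) (by nlinarith [sq_nonneg (x + u)])
    _ = _ := by field_simp

lemma case_one (p : ℝ → ℝ) (hp0 : ∀ x, 0 ≤ p x) (hpc : Continuous p) (hpi : Integrable p)
    (hp : ∀ x : ℝ, (p x : ℂ) = (Gf 1 1 x + Gf 1 1 (-x)) / (2 * π)) :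
    ∃ C > 0, (∫⁻ z, ENNReal.ofReal |Lop1 p z|) ≤ ENNReal.ofReal C := by
  have hG : ∀ x : ℝ, Gf 1 1 x = 1 / (1 + Complex.I * x) := by
    intro x
    have := integral_exp_mul_complex_Ioi (a := -(1 + Complex.I * x)) (by simp) 0
    rw [Gf]
    have e : ∀ l : ℝ, ek 1 1 x l = Complex.exp (-(1 + Complex.I * x) * l) := by
      intro l
      rw [ek, ← Complex.exp_add, Real.rpow_one]; congr 1; ring
    simp_rw [e]
    rw [this]
    rw [neg_div_neg_eq]; simp
  have hpe : p = fun x => (1 / (1 + x ^ 2)) / π := by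
    ext x
    apply Complex.ofReal_injective
    rw [hp, hG, hG]
    have n1 : (1 + Complex.I * x : ℂ) ≠ 0 := fun h => by
      simpa using congrArg Complex.re h
    have n2 : (1 + Complex.I * ((-x : ℝ) : ℂ) : ℂ) ≠ 0 := fun h => by
      simpa using congrArg Complex.re h
    have n3 : (1 + (x:ℂ) ^ 2) = (1 + Complex.I * x) * (1 + Complex.I * ((-x : ℝ) : ℂ)) := by
      push_cast; linear_combination ((x:ℂ)^2) * Complex.I_sq
    have n4 : (π : ℂ) ≠ 0 := by exact_mod_cast Real.pi_ne_zero
    push_cast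
    rw [n3]
    have n5 : (((-x : ℝ)) : ℂ) = -(x:ℂ) := by push_cast; rfl
    rw [n5] at n2 ⊢
    generalize hA : 1 + Complex.I * (x:ℂ) = A at *
    have hB : 1 + Complex.I * -(x:ℂ) = 2 - A := by rw [← hA]; ring
    rw [hB] at n2 ⊢
    field_simp
    ring
  have hder : ∀ x, deriv p x = (-(2 * x) / (1 + x ^ 2) ^ 2) / π := by
    intro x
    rw [hpe]
    have h1 : HasDerivAt (fun x : ℝ => 1 + x ^ 2) (2 * x) x := by
      simpa using (hasDerivAt_pow 2 x).const_add 1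
    have := ((h1.inv (by positivity)).div_const π).deriv
    simp only [one_div]
    exact this
  refine final_bound _ (s := 0) (t := -2)
    (K := 6) (M := 1) (by norm_num) (by norm_num) (by norm_num)
    (by norm_num) p hp0 hpc hpi ?_
  intro z u
  have hpi1 : 1 ≤ π := by linarith [Real.pi_gt_three]
  unfold wf kf
  split_ifs with hu
  · by_cases h0 : u = 0
    · simp [h0]; positivity
    have e : p (z + u) - p z - u * deriv p z = (1 / (1 + (z + u) ^ 2) - 1 / (1 + z ^ 2) -
        u * (-(2 * z) / (1 + z ^ 2) ^ 2)) / π := by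
      rw [hder, hpe]; ring
    have hu2 : 0 < u ^ 2 := by positivity
    rw [e, abs_mul, abs_div, abs_of_pos (show 0 < 1 / (π * u ^ 2) by positivity), abs_of_pos Real.pi_pos]
    have := cauchy_diff z u hu
    calc _ ≤ (6 / (1 + z ^ 2) * u ^ 2) / 1 * (1 / (1 * u ^ 2)) := by gcongr
      _ = _ := by simp; field_simp
  · rw [mul_zero, zero_add, sub_zero, abs_mul, one_mul]
    have hu0 : 0 < |u| := by linarith [not_le.1 hu]
    refine mul_le_mul ?_ ?_ (abs_nonneg _) (add_nonneg (hp0 _) (hp0 _))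
    · rw [abs_le]; constructor <;> linarith [hp0 z, hp0 (z + u)]
    · have h2 : |u| ^ (-2 : ℝ) = 1 / (1 * u ^ 2) := by
        rw [Real.rpow_neg hu0.le, one_mul, one_div, ← sq_abs u]; norm_cast
      have hu2 : 0 < u ^ 2 := by rw [← sq_abs]; positivity
      rw [h2, abs_of_pos (by positivity)]
      gcongr

/-- Lemma 3.6: `∫ |L^{α,δ} p(z)| dz ≤ C_α` for the stable density `p`. -/
theorem Lop_density_L1_bound
    (α δ : ℝ) (hα0 : 0 < α) (hα1 : α ≤ 1) (hδ : δ ∈ Set.Ioo (-1 : ℝ) 1)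
    (h1 : α = 1 → δ = 0)
    (μZ : Measure ℝ) [IsProbabilityMeasure μZ] (hZ : IsStableLaw α δ μZ)
    (p : ℝ → ℝ) (hp0 : ∀ x, 0 ≤ p x) (hpc : Continuous p)
    (hpd : μZ = volume.withDensity fun x => ENNReal.ofReal (p x)) :
    ∃ C > 0, (∫⁻ z, ENNReal.ofReal |LopA α δ p z|) ≤ ENNReal.ofReal C := by
  have hm : Measurable (fun x => ENNReal.ofReal (p x)) := hpc.measurable.ennreal_ofReal
  have hpi : Integrable p := by
    refine ⟨hpc.aestronglyMeasurable, ?_⟩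
    rw [hasFiniteIntegral_iff_ofReal (Eventually.of_forall hp0)]
    have h : μZ univ = 1 := measure_univ
    rw [hpd, withDensity_apply _ MeasurableSet.univ, setLIntegral_univ] at h
    rw [h]; exact ENNReal.one_lt_top
  have hcf : ∀ l : ℝ, ∫ x : ℝ, Complex.exp (Complex.I * l * x) * (p x : ℂ) = stableCF α δ 1 l := by
    intro l
    rw [← hZ l, hpd, integral_withDensity_eq_integral_toReal_smul hm
      (Eventually.of_forall fun x => ENNReal.ofReal_lt_top)]
    congr 1; ext x
    rw [ENNReal.toReal_ofReal (hp0 x), Complex.real_smul, mul_comm]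
  by_cases h : α = 1
  · simp only [LopA, if_pos h]
    refine case_one p hp0 hpc hpi (density_eq (φ := stableCF α δ 1) one_pos (by simp) (by simp) ?_ ?_ p hpc hpi hcf)
    · intro l hl
      simp [stableCF, h, abs_of_pos hl]
    · intro l hl
      simp [stableCF, h, abs_of_pos hl]
  · simp only [LopA, if_neg h]
    refine case_lt hα0 (lt_of_le_of_ne hα1 h) hδ p hp0 hpc hpi ?_
    have hre : ∀ r : ℝ, (1 - Complex.I * δ * r : ℂ).re = 1 := by intro r; simp
    refine p_diff (c := 1 - Complex.I * δ * (Real.tan (π * α / 2) : ℝ))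
      (c' := 1 - Complex.I * δ * ((-Real.tan (π * α / 2) : ℝ) : ℂ)) hα0 (hre _) (hre _) p
      (density_eq (φ := stableCF α δ 1) hα0 (hre _) (hre _) ?_ ?_ p hpc hpi hcf)
    · intro l hl
      rw [stableCF, if_neg h, abs_of_pos hl, Real.sign_of_pos hl]
      congr 1; push_cast; ring
    · intro l hl
      rw [stableCF, if_neg h, abs_neg, abs_of_pos hl, Real.sign_of_neg (neg_neg_of_pos hl)]
      congr 1; push_cast; ring
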